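/- Let U be an ultrafilter on a set ι and for each i let (F i, f i) →^{q i} (E i, e i) →^{p i} (B i, b i) be a sequence of morphisms of pointed simplicial sets such that {i | the sequence is a fibre sequence} ∈ U, where a sequence is a fibre sequence if: p is a Kan fibration and each p_n is surjective; each q_n is injective; and for every n ∈ ℕ, the image q_n(F_n) equals p_n^{-1}(e_n(b)), where e_n(b) denotes the n-fold degenerate basepoint σ^{n-1}⋯σ^0 b (and e₀(b) = b). Then the induced sequence of restricted ultraproducts (∏_U F i, f) → (∏_U E i, e) → (∏_U B i, b), with germwise maps and germ basepoints, is again a fibre sequence. -/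

import Mathlib

open CategoryTheory Limits Simplicial

universe v u w

/-- The setoid of `U`-almost-everywhere equality on the dependent product `∀ i, S i`. -/
def germSetoid {ι : Type u} (U : Ultrafilter ι) (S : ι → Type v) :
    Setoid (∀ i, S i) where
  r s t := {i | s i = t i} ∈ U
  iseqv := by
    constructor
    · intro s
      exact Filter.univ_mem' (fun i => rfl)
    · intro s t h
      exact Filter.mem_of_superset h (fun i hi => hi.symm)
    · intro s t u h₁ h₂
      exact Filter.mem_of_superset (Filter.inter_mem h₁ h₂) (fun i hi => hi.1.trans hi.2)

/-- The ultraproduct `∏_U S i` of a family of sets: the quotient of `∀ i, S i` by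
`U`-almost-everywhere equality. -/
def Ultraproduct {ι : Type u} (U : Ultrafilter ι) (S : ι → Type v) : Type (max u v) :=
  Quotient (germSetoid U S)

/-- The germ `[s]` of a family `s`. -/
def Ultraproduct.mk {ι : Type u} (U : Ultrafilter ι) {S : ι → Type v} (s : ∀ i, S i) :
    Ultraproduct U S :=
  Quotient.mk (germSetoid U S) s

/-- The ultraproduct category `∏_U C i`: objects are families of objects,
hom-sets are ultraproducts of hom-sets, with germwise composition and
germs of identities as identities. -/
def UltraCat {ι : Type u} (U : Ultrafilter ι) (C : ι → Type v)
    [∀ i, Category.{w} (C i)] : Type (max u v) :=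
  ∀ i, C i

set_option linter.unusedVariables false in
instance UltraCat.instCategory {ι : Type u} (U : Ultrafilter ι) (C : ι → Type v)
    [∀ i, Category.{w} (C i)] : Category.{max u w} (UltraCat U C) where
  Hom X Y := Ultraproduct U (fun i => X i ⟶ Y i)
  id X := Ultraproduct.mk U (fun i => 𝟙 (X i))
  comp {X Y Z} f g :=
    Quotient.liftOn₂ f g
      (fun f g => Ultraproduct.mk U (fun i => f i ≫ g i))
      (by
        intro a₁ a₂ b₁ b₂ h₁ h₂
        exact Quotient.sound (Filter.mem_of_superset (Filter.inter_mem h₁ h₂)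
          (fun i hi => by
            have e₁ : a₁ i = b₁ i := hi.1
            have e₂ : a₂ i = b₂ i := hi.2
            show a₁ i ≫ a₂ i = b₁ i ≫ b₂ i
            rw [e₁, e₂])))
  id_comp := by
    intro X Y f
    induction f using Quotient.inductionOn with
    | _ a => exact congrArg (Quotient.mk _) (funext fun i => Category.id_comp (a i))
  comp_id := by
    intro X Y f
    induction f using Quotient.inductionOn with
    | _ a => exact congrArg (Quotient.mk _) (funext fun i => Category.comp_id (a i))
  assoc := by
    intro W X Y Z f g h
    induction f using Quotient.inductionOn with
    | _ a =>
      induction g using Quotient.inductionOn with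
      | _ b =>
        induction h using Quotient.inductionOn with
        | _ c => exact congrArg (Quotient.mk _) (funext fun i => Category.assoc (a i) (b i) (c i))

/-- The morphism of the ultraproduct category determined by a family of morphisms. -/
def UltraCat.mkHom {ι : Type u} (U : Ultrafilter ι) {C : ι → Type v}
    [∀ i, Category.{w} (C i)] {X Y : UltraCat U C} (f : ∀ i, X i ⟶ Y i) : X ⟶ Y :=
  Ultraproduct.mk U f

/-- The restricted ultraproduct of a family of simplicial sets: its `n`-simplices form
the ultraproduct of the sets of `n`-simplices, with germwise structure maps. -/
def ultraSSet {ι : Type u} (U : Ultrafilter ι) (X : ι → SSet.{v}) : SSet.{max u v} where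
  obj m := Ultraproduct U (fun i => (X i).obj m)
  map {m m'} φ :=
    TypeCat.ofHom <| Quotient.map (fun s i => (X i).map φ (s i))
      (by
        intro s t h
        exact Filter.mem_of_superset h (fun i hi => by
          show (X i).map φ (s i) = (X i).map φ (t i)
          rw [show s i = t i from hi]))
  map_id := by
    intro m
    refine ConcreteCategory.hom_ext _ _ fun a => ?_
    induction a using Quotient.inductionOn with
    | _ s =>
      exact congrArg (Quotient.mk _) (funext fun i => ConcreteCategory.congr_hom ((X i).map_id m) (s i))
  map_comp := by
    intro m m' m'' φ ψ
    refine ConcreteCategory.hom_ext _ _ fun a => ?_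
    induction a using Quotient.inductionOn with
    | _ s =>
      exact congrArg (Quotient.mk _) (funext fun i => ConcreteCategory.congr_hom ((X i).map_comp φ ψ) (s i))

/-- The germwise morphism between restricted ultraproducts induced by a family of
morphisms of simplicial sets. -/
def ultraSSetMap {ι : Type u} (U : Ultrafilter ι) {X Z : ι → SSet.{v}}
    (f : ∀ i, X i ⟶ Z i) : ultraSSet U X ⟶ ultraSSet U Z where
  app m :=
    TypeCat.ofHom <| Quotient.map (fun s i => (f i).app m (s i))
      (by
        intro s t h
        exact Filter.mem_of_superset h (fun i hi => by
          show (f i).app m (s i) = (f i).app m (t i)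
          rw [show s i = t i from hi]))
  naturality := by
    intro m m' φ
    refine ConcreteCategory.hom_ext _ _ fun a => ?_
    induction a using Quotient.inductionOn with
    | _ s =>
      exact congrArg (Quotient.mk _) (funext fun i => ConcreteCategory.congr_hom ((f i).naturality φ) (s i))

/-- A simplicial set `Y` is a Kan complex if for all `n ≥ 1` and `0 ≤ k ≤ n`, every map
from the horn `Λ[n, k]` to `Y` extends along `Λ[n, k] ↪ Δ[n]` to a map `Δ[n] ⟶ Y`. -/
def IsKan (Y : SSet.{v}) : Prop :=
  ∀ (n : ℕ), 1 ≤ n → ∀ (k : Fin (n + 1)) (σ : (Λ[n, k] : SSet.{v}) ⟶ Y),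
    ∃ τ : Δ[n] ⟶ Y, Λ[n, k].ι ≫ τ = σ

/-- A morphism of simplicial sets is a Kan fibration if it has the right lifting
property with respect to every horn inclusion `Λ[n, k] ↪ Δ[n]` (`n ≥ 1`, `0 ≤ k ≤ n`). -/
def IsKanFibration {X Z : SSet.{v}} (p : X ⟶ Z) : Prop :=
  ∀ (n : ℕ), 1 ≤ n → ∀ (k : Fin (n + 1)) (a : (Λ[n, k] : SSet.{v}) ⟶ X) (b : Δ[n] ⟶ Z),
    a ≫ p = Λ[n, k].ι ≫ b →
    ∃ c : Δ[n] ⟶ X, Λ[n, k].ι ≫ c = a ∧ c ≫ p = b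

/-- The `m`-fold degenerate basepoint `e_m = σ^{m-1} ⋯ σ^0 b` (with `e_0 = b`). -/
def degPt (B : SSet.{v}) (b : B _⦋0⦌) : ∀ m : ℕ, B _⦋m⦌
  | 0 => b
  | m + 1 => B.σ (Fin.last m) (degPt B b m)

/-- A sequence `F ⟶ E ⟶ B` of (pointed) simplicial sets is a fibre sequence if `p` is
a Kan fibration with all levels `p_n` surjective, all levels `q_n` are injective, and
for each `n` the image of `q_n` is exactly the fibre `p_n⁻¹(e_n(b))` over the `n`-fold
degenerate basepoint. -/
def IsFibreSequence {F E B : SSet.{v}} (q : F ⟶ E) (p : E ⟶ B) (b : B _⦋0⦌) : Prop :=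
  IsKanFibration p ∧
  (∀ n : ℕ, Function.Surjective (p.app (Opposite.op (SimplexCategory.mk n)))) ∧
  (∀ n : ℕ, Function.Injective (q.app (Opposite.op (SimplexCategory.mk n)))) ∧
  (∀ n : ℕ, Set.range (q.app (Opposite.op (SimplexCategory.mk n))) =
    p.app (Opposite.op (SimplexCategory.mk n)) ⁻¹' {degPt B b n})

namespace UltraAux

lemma mk_eq {ι : Type u} {U : Ultrafilter ι} {S : ι → Type v} {s t : ∀ i, S i} :
    Ultraproduct.mk U s = Ultraproduct.mk U t ↔ ∀ᶠ i in (U : Filter ι), s i = t i := by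
  constructor
  · intro h
    exact Quotient.exact h
  · intro h
    exact Quotient.sound h

lemma mk_surj {ι : Type u} {U : Ultrafilter ι} {S : ι → Type v} (a : Ultraproduct U S) :
    ∃ s, Ultraproduct.mk U s = a := Quotient.exists_rep a

lemma choice {ι : Type u} {U : Ultrafilter ι} {S : ι → Type v} (d : ∀ i, S i)
    {P : ∀ i, S i → Prop} (h : ∀ᶠ i in (U : Filter ι), ∃ x, P i x) :
    ∃ s : ∀ i, S i, ∀ᶠ i in (U : Filter ι), P i (s i) := by
  classical
  refine ⟨fun i => if hi : ∃ x, P i x then hi.choose else d i, ?_⟩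
  filter_upwards [h] with i hi
  rw [dif_pos hi]
  exact hi.choose_spec

lemma δ_mk {ι : Type u} (U : Ultrafilter ι) (X : ι → SSet.{v}) {n : ℕ} (j : Fin (n + 2))
    (s : ∀ i, (X i) _⦋n + 1⦌) :
    (ultraSSet U X).δ j (Ultraproduct.mk U s : (ultraSSet U X) _⦋n + 1⦌) =
      (Ultraproduct.mk U (fun i => (X i).δ j (s i)) : (ultraSSet U X) _⦋n⦌) := rfl

lemma app_mk {ι : Type u} (U : Ultrafilter ι) {X Z : ι → SSet.{v}} (f : ∀ i, X i ⟶ Z i)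
    (m : SimplexCategoryᵒᵖ) (s : ∀ i, (X i).obj m) :
    (ultraSSetMap U f).app m (Ultraproduct.mk U s : (ultraSSet U X).obj m) =
      (Ultraproduct.mk U (fun i => (f i).app m (s i)) : (ultraSSet U Z).obj m) := rfl

lemma degPt_mk {ι : Type u} (U : Ultrafilter ι) (B : ι → SSet.{v}) (b : ∀ i, (B i) _⦋0⦌)
    (n : ℕ) :
    degPt (ultraSSet U B) (Ultraproduct.mk U b) n =
      (Ultraproduct.mk U (fun i => degPt (B i) (b i) n) : (ultraSSet U B) _⦋n⦌) := by
  induction n with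
  | zero => rfl
  | succ n ih =>
    simp only [degPt]
    rw [ih]
    rfl

/-- Compatibility of faces of a horn. -/
def HCompat (X : SSet.{v}) {n : ℕ} (k : Fin (n + 2)) (x : ∀ j : Fin (n + 2), j ≠ k → X _⦋n⦌) :
    Prop :=
  match n with
  | 0 => True
  | n + 1 => ∀ (j l : Fin (n + 3)) (hj : j ≠ k) (hl : l ≠ k) (hjl : j < l),
      X.δ (l.pred (Fin.ne_zero_of_lt hjl)) (x j hj) =
      X.δ (j.castPred (Fin.ne_last_of_lt hjl)) (x l hl)

/-- Combinatorial Kan condition. -/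
def CKan {X Z : SSet.{v}} (p : X ⟶ Z) (n : ℕ) (k : Fin (n + 2)) : Prop :=
  ∀ (x : ∀ j : Fin (n + 2), j ≠ k → X _⦋n⦌), HCompat X k x → ∀ y : Z _⦋n + 1⦌,
    (∀ j hj, p.app _ (x j hj) = Z.δ j y) →
    ∃ w : X _⦋n + 1⦌, (∀ j hj, X.δ j w = x j hj) ∧ p.app _ w = y

lemma δ_symm {X : SSet.{v}} {n : ℕ} (j : Fin (n + 2)) (x : X _⦋n + 1⦌) :
    SSet.stdSimplex.δ j ≫ SSet.yonedaEquiv.symm x = SSet.yonedaEquiv.symm (X.δ j x) :=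
  SSet.yonedaEquiv_symm_naturality_left _ _

lemma hcompat_iff {X : SSet.{v}} {n : ℕ} (k : Fin (n + 2))
    (x : ∀ j : Fin (n + 2), j ≠ k → X _⦋n⦌) :
    HCompat X k x ↔ SSet.horn.IsCompatible
      (i := k) (fun j hj => SSet.yonedaEquiv.symm (x j hj)) := by
  cases n with
  | zero => simp [HCompat]
  | succ n =>
    simp only [HCompat, SSet.horn.isCompatible_iff, δ_symm, EmbeddingLike.apply_eq_iff_eq]

lemma kan_iff {X Z : SSet.{v}} (p : X ⟶ Z) :
    IsKanFibration p ↔ ∀ n k, CKan p n k := by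
  constructor
  · intro h n k x hx y hy
    have hc := (hcompat_iff k x).1 hx
    obtain ⟨c, h1, h2⟩ := h (n + 1) (by omega) k hc.desc (SSet.yonedaEquiv.symm y) (by
      apply SSet.horn.hom_ext'
      intro j hj
      rw [SSet.horn.IsCompatible.ι_desc_assoc, SSet.horn.ι_ι_assoc, δ_symm,
        SSet.yonedaEquiv_symm_comp, hy])
    obtain ⟨w, rfl⟩ := SSet.yonedaEquiv.symm.surjective c
    refine ⟨w, fun j hj => ?_, ?_⟩
    · apply SSet.yonedaEquiv.symm.injective
      rw [← δ_symm, ← SSet.horn.ι_ι_assoc k j hj, h1, SSet.horn.IsCompatible.ι_desc]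
    · apply SSet.yonedaEquiv.symm.injective
      rw [← h2, SSet.yonedaEquiv_symm_comp]
  · intro h n hn k a b hab
    obtain ⟨n, rfl⟩ : ∃ m, n = m + 1 := ⟨n - 1, by omega⟩
    obtain ⟨y, rfl⟩ := SSet.yonedaEquiv.symm.surjective b
    obtain ⟨w, h1, h2⟩ := h n k (fun j hj => SSet.yonedaEquiv (SSet.horn.ι k j hj ≫ a))
      (by
        rw [hcompat_iff]
        simp only [Equiv.symm_apply_apply]
        exact SSet.horn.IsCompatible.of_hom a) y
      (by
        intro j hj
        apply SSet.yonedaEquiv.symm.injective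
        rw [← SSet.yonedaEquiv_symm_comp, Equiv.symm_apply_apply, Category.assoc, hab,
          SSet.horn.ι_ι_assoc, δ_symm])
    refine ⟨SSet.yonedaEquiv.symm w, ?_, ?_⟩
    · apply SSet.horn.hom_ext'
      intro j hj
      rw [SSet.horn.ι_ι_assoc, δ_symm, h1, Equiv.symm_apply_apply]
    · rw [SSet.yonedaEquiv_symm_comp, h2]

lemma hcompat_mk {ι : Type u} (U : Ultrafilter ι) (X : ι → SSet.{v}) {n : ℕ} (k : Fin (n + 2))
    (s : ∀ j : Fin (n + 2), j ≠ k → ∀ i, (X i) _⦋n⦌)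
    (h : HCompat (ultraSSet U X) k (fun j hj => Ultraproduct.mk U (s j hj))) :
    ∀ᶠ i in (U : Filter ι), HCompat (X i) k (fun j hj => s j hj i) := by
  cases n with
  | zero => exact Filter.Eventually.of_forall fun _ => trivial
  | succ n =>
    simp only [HCompat, Filter.eventually_all]
    intro j l hj hl hjl
    exact mk_eq.1 (h j l hj hl hjl)

end UltraAux

open UltraAux

/-- if `U`-almost every member of a family of sequences of pointed
simplicial sets is a fibre sequence, then the induced germwise sequence of restricted
ultraproducts, with the germ basepoints, is again a fibre sequence. -/
theorem ultraSSet_fibreSequence {ι : Type u} (U : Ultrafilter ι)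
    {F E B : ι → SSet.{v}} (q : ∀ i, F i ⟶ E i) (p : ∀ i, E i ⟶ B i)
    (f : ∀ i, (F i) _⦋0⦌) (e : ∀ i, (E i) _⦋0⦌) (b : ∀ i, (B i) _⦋0⦌)
    (hq : ∀ i, (q i).app (Opposite.op (SimplexCategory.mk 0)) (f i) = e i)
    (hp : ∀ i, (p i).app (Opposite.op (SimplexCategory.mk 0)) (e i) = b i)
    (h : {i | IsFibreSequence (q i) (p i) (b i)} ∈ U) :
    IsFibreSequence (ultraSSetMap U q) (ultraSSetMap U p) (Ultraproduct.mk U b) := by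
  have h' : ∀ᶠ i in (U : Filter ι), IsFibreSequence (q i) (p i) (b i) := h
  refine ⟨?_, ?_, ?_, ?_⟩
  · rw [kan_iff]
    intro n k x hx y hy
    have hs : ∀ j hj, ∃ s, Ultraproduct.mk U s = x j hj := fun j hj => mk_surj (x j hj)
    choose s hs using hs
    obtain rfl : (fun j hj => Ultraproduct.mk U (s j hj)) = x := by
      funext j hj
      exact hs j hj
    obtain ⟨t, rfl⟩ := mk_surj y
    have h1 := hcompat_mk U E k s hx
    have h2 : ∀ᶠ i in (U : Filter ι), ∀ j hj,
        (p i).app _ (s j hj i) = (B i).δ j (t i) := by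
      simp only [Filter.eventually_all]
      intro j hj
      exact mk_eq.1 (hy j hj)
    obtain ⟨w, hw⟩ := choice (U := U) (fun i => degPt (E i) (e i) (n + 1))
      (P := fun i w => (∀ j hj, (E i).δ j w = s j hj i) ∧ (p i).app _ w = t i) (by
        filter_upwards [h', h1, h2] with i hi h1 h2
        exact (kan_iff _).1 hi.1 n k _ h1 _ h2)
    refine ⟨Ultraproduct.mk U w, fun j hj => mk_eq.2 ?_, mk_eq.2 ?_⟩
    · filter_upwards [hw] with i hi using hi.1 j hj
    · filter_upwards [hw] with i hi using hi.2
  · intro n y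
    obtain ⟨t, rfl⟩ := mk_surj y
    obtain ⟨w, hw⟩ := choice (U := U) (fun i => degPt (E i) (e i) n)
      (P := fun i w => (p i).app _ w = t i) (by
        filter_upwards [h'] with i hi using hi.2.1 n (t i))
    exact ⟨Ultraproduct.mk U w, mk_eq.2 hw⟩
  · intro n x y hxy
    obtain ⟨s, rfl⟩ := mk_surj x
    obtain ⟨t, rfl⟩ := mk_surj y
    have h1 := mk_eq.1 hxy
    refine mk_eq.2 ?_
    filter_upwards [h', h1] with i hi h1 using hi.2.2.1 n h1
  · intro n
    ext x
    obtain ⟨s, rfl⟩ := mk_surj x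
    simp only [Set.mem_range, Set.mem_preimage, Set.mem_singleton_iff, degPt_mk]
    constructor
    · rintro ⟨y, hy⟩
      obtain ⟨t, rfl⟩ := mk_surj y
      have h1 := mk_eq.1 hy
      refine mk_eq.2 ?_
      filter_upwards [h', h1] with i hi h1
      have := hi.2.2.2 n
      exact this.subset ⟨t i, h1⟩
    · intro hx
      have h1 := mk_eq.1 hx
      obtain ⟨w, hw⟩ := choice (U := U) (fun i => degPt (F i) (f i) n)
        (P := fun i w => (q i).app _ w = s i) (by
          filter_upwards [h', h1] with i hi h1
          exact (hi.2.2.2 n).superset h1)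
      exact ⟨Ultraproduct.mk U w, mk_eq.2 hw⟩
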